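/- Assume the BV function x:[0,T]→ℝ is continuous and satisfies the strong local stability and the energy-dissipation upper bound. If t∈(0,T) is an accumulation point of the boundary ∂int(N) of int(N), then ∂ₓₜ𝓔(t,x(t)) = 0. Moreover, if in addition ∂ₓₓ𝓔(t,x(t)) ≠ 0, then x'(t) exists with x'(t) = 0, and ∂ₓₜₜ𝓔(t,x(t)) = 0. -/

import Mathlib

open Set Filter Topology MeasureTheory

/-- Dissipation of `x` on `[t₁,t₂]`: total variation of `x` on the interval. -/
noncomputable def Diss (x : ℝ → ℝ) (t₁ t₂ : ℝ) : ℝ :=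
  (eVariationOn x (Set.Icc t₁ t₂)).toReal

/-- ∂ₓ𝓔 -/
noncomputable def pEx (E : ℝ → ℝ → ℝ) (t y : ℝ) : ℝ := deriv (fun z => E t z) y
/-- ∂ₜ𝓔 -/
noncomputable def pEt (E : ℝ → ℝ → ℝ) (t y : ℝ) : ℝ := deriv (fun s => E s y) t
/-- ∂ₓₓ𝓔 -/
noncomputable def pExx (E : ℝ → ℝ → ℝ) (t y : ℝ) : ℝ := deriv (fun z => pEx E t z) y
/-- ∂ₓₓₓ𝓔 -/
noncomputable def pExxx (E : ℝ → ℝ → ℝ) (t y : ℝ) : ℝ := deriv (fun z => pExx E t z) y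
/-- ∂ₓₜ𝓔 -/
noncomputable def pExt (E : ℝ → ℝ → ℝ) (t y : ℝ) : ℝ := deriv (fun s => pEx E s y) t
/-- ∂ₓₓₜ𝓔 -/
noncomputable def pExxt (E : ℝ → ℝ → ℝ) (t y : ℝ) : ℝ := deriv (fun s => pExx E s y) t
/-- ∂ₓₜₜ𝓔 -/
noncomputable def pExtt (E : ℝ → ℝ → ℝ) (t y : ℝ) : ℝ := deriv (fun s => pExt E s y) t

/-- The jump set of `x` on `[0,T]`: points of discontinuity. -/
def JumpSet (x : ℝ → ℝ) (T : ℝ) : Set ℝ :=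
  {t ∈ Set.Icc 0 T | ¬ ContinuousWithinAt x (Set.Icc 0 T) t}

/-- N := {t ∈ (0,T) : x'(t) exists and equals 0}. -/
def NullSet (x : ℝ → ℝ) (T : ℝ) : Set ℝ :=
  {t ∈ Set.Ioo 0 T | HasDerivAt x 0 t}

/-- Weak local stability: |∂ₓ𝓔(t,x(t))| ≤ 1 at every continuity point of x in [0,T]. -/
def WeakLS (E : ℝ → ℝ → ℝ) (x : ℝ → ℝ) (T : ℝ) : Prop :=
  ∀ t ∈ Set.Icc 0 T, ContinuousWithinAt x (Set.Icc 0 T) t → |pEx E t (x t)| ≤ 1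

/-- Strong local stability: x(t) local minimizer of z ↦ 𝓔(t,z)+|z−x(t)| off the jump set. -/
def StrongLS (E : ℝ → ℝ → ℝ) (x : ℝ → ℝ) (T : ℝ) : Prop :=
  ∀ t ∈ Set.Icc 0 T \ JumpSet x T, IsLocalMin (fun z => E t z + |z - x t|) (x t)

/-- Energy-dissipation upper bound. -/
def EDUB (E : ℝ → ℝ → ℝ) (x : ℝ → ℝ) (T : ℝ) : Prop :=
  ∀ t₁ t₂ : ℝ, 0 ≤ t₁ → t₁ ≤ t₂ → t₂ ≤ T →
    E t₂ (x t₂) - E t₁ (x t₁) ≤ (∫ s in t₁..t₂, pEt E s (x s)) - Diss x t₁ t₂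

/-- (H1): {(t,x) ∈ (0,T)×ℝ : ∂ₓ𝓔 ∈ {−1,1}, ∂ₓₓ𝓔 = ∂ₓₓₓ𝓔 = 0} is finite. -/
def H1cond (E : ℝ → ℝ → ℝ) (T : ℝ) : Prop :=
  {p : ℝ × ℝ | p.1 ∈ Set.Ioo 0 T ∧ (pEx E p.1 p.2 = -1 ∨ pEx E p.1 p.2 = 1) ∧
    pExx E p.1 p.2 = 0 ∧ pExxx E p.1 p.2 = 0}.Finite

/-- (H2). -/
def H2cond (E : ℝ → ℝ → ℝ) (T : ℝ) : Prop :=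
  {p : ℝ × ℝ | p.1 ∈ Set.Ioo 0 T ∧ (pEx E p.1 p.2 = -1 ∨ pEx E p.1 p.2 = 1) ∧
    pExx E p.1 p.2 = 0 ∧ pExt E p.1 p.2 = 0 ∧
    (pExxt E p.1 p.2) ^ 2 = pExtt E p.1 p.2 * pExxx E p.1 p.2}.Finite

/-- (H3). -/
def H3cond (E : ℝ → ℝ → ℝ) (T : ℝ) : Prop :=
  {p : ℝ × ℝ | p.1 ∈ Set.Ioo 0 T ∧ (pEx E p.1 p.2 = -1 ∨ pEx E p.1 p.2 = 1) ∧
    pExx E p.1 p.2 = 0 ∧ pExt E p.1 p.2 = 0}.Finite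

/-- (H4). -/
def H4cond (E : ℝ → ℝ → ℝ) (T : ℝ) : Prop :=
  {p : ℝ × ℝ | p.1 ∈ Set.Icc 0 T ∧ (pEx E p.1 p.2 = -1 ∨ pEx E p.1 p.2 = 1) ∧
    pExt E p.1 p.2 = 0 ∧ pExtt E p.1 p.2 = 0} = ∅

/-- (H5). -/
def H5cond (E : ℝ → ℝ → ℝ) (T : ℝ) : Prop :=
  {p : ℝ × ℝ | p.1 ∈ Set.Icc 0 T ∧ (pEx E p.1 p.2 = -1 ∨ pEx E p.1 p.2 = 1) ∧
    pExx E p.1 p.2 = 0} = ∅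

section PartialDerivatives

variable {G : ℝ → ℝ → ℝ}

lemma hasDerivAt_fst_of_differentiable (hG : Differentiable ℝ (Function.uncurry G)) (t y : ℝ) :
    HasDerivAt (fun s => G s y) (fderiv ℝ (Function.uncurry G) (t, y) (1, 0)) t :=
  HasFDerivAt.comp_hasDerivAt (f := fun s => (s, y)) t (hG (t, y)).hasFDerivAt
    ((hasDerivAt_id t).prodMk (hasDerivAt_const t y))

lemma hasDerivAt_snd_of_differentiable (hG : Differentiable ℝ (Function.uncurry G)) (t y : ℝ) :
    HasDerivAt (fun z => G t z) (fderiv ℝ (Function.uncurry G) (t, y) (0, 1)) y :=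
  (hG (t, y)).hasFDerivAt.comp_hasDerivAt y ((hasDerivAt_const y t).prodMk (hasDerivAt_id y))

lemma contDiff_deriv_fst {m n : WithTop ℕ∞} (hG : ContDiff ℝ n (Function.uncurry G))
    (hmn : m + 1 ≤ n) :
    ContDiff ℝ m (Function.uncurry fun t y => deriv (fun s => G s y) t) := by
  have hd : Differentiable ℝ (Function.uncurry G) :=
    (hG.of_le (le_trans le_add_self hmn)).differentiable one_ne_zero
  have h : (Function.uncurry fun t y => deriv (fun s => G s y) t) =
      fun p => fderiv ℝ (Function.uncurry G) p (1, 0) := by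
    ext ⟨t, y⟩
    exact (hasDerivAt_fst_of_differentiable hd t y).deriv
  rw [h]
  exact (hG.fderiv_right hmn).clm_apply contDiff_const

lemma contDiff_deriv_snd {m n : WithTop ℕ∞} (hG : ContDiff ℝ n (Function.uncurry G))
    (hmn : m + 1 ≤ n) :
    ContDiff ℝ m (Function.uncurry fun t y => deriv (fun z => G t z) y) := by
  have hd : Differentiable ℝ (Function.uncurry G) :=
    (hG.of_le (le_trans le_add_self hmn)).differentiable one_ne_zero
  have h : (Function.uncurry fun t y => deriv (fun z => G t z) y) =
      fun p => fderiv ℝ (Function.uncurry G) p (0, 1) := by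
    ext ⟨t, y⟩
    exact (hasDerivAt_snd_of_differentiable hd t y).deriv
  rw [h]
  exact (hG.fderiv_right hmn).clm_apply contDiff_const

/-- Along a curve with vanishing velocity, only the explicit time dependence contributes. -/
lemma hasDerivAt_comp_curve_of_hasDerivAt_zero (hG : Differentiable ℝ (Function.uncurry G))
    {x : ℝ → ℝ} {s : ℝ} (hx : HasDerivAt x 0 s) :
    HasDerivAt (fun r => G r (x r)) (deriv (fun r => G r (x s)) s) s := by
  rw [(hasDerivAt_fst_of_differentiable hG s (x s)).deriv]
  exact (hG (s, x s)).hasFDerivAt.comp_hasDerivAt s ((hasDerivAt_id s).prodMk hx)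

end PartialDerivatives

section RealLine

lemma eq_of_forall_hasDerivAt_zero {f : ℝ → ℝ} {a b : ℝ} (hf : ContinuousOn f (uIcc a b))
    (hf' : ∀ s ∈ Ioo (min a b) (max a b), HasDerivAt f 0 s) : f a = f b := by
  wlog hab : a ≤ b generalizing a b
  · exact (this (uIcc_comm a b ▸ hf) (by rwa [min_comm, max_comm]) (le_of_not_ge hab)).symm
  rcases hab.eq_or_lt with rfl | hlt
  · rfl
  rw [min_eq_left hab, max_eq_right hab] at hf'
  rw [uIcc_of_le hab] at hf
  obtain ⟨c, -, hc⟩ := exists_hasDerivAt_eq_slope f (fun _ => 0) hlt hf hf'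
  have := sub_pos.2 hlt
  field_simp at hc
  linarith

lemma abs_deriv_le_one_of_isLocalMin_add_abs {f : ℝ → ℝ} {a d : ℝ} (hf : HasDerivAt f d a)
    (hmin : IsLocalMin (fun z => f z + |z - a|) a) : |d| ≤ 1 := by
  have hev : ∀ᶠ z in 𝓝 a, f a ≤ f z + |z - a| := by
    filter_upwards [hmin] with z hz
    simpa using hz
  have hs := hf.tendsto_slope
  rw [abs_le]
  constructor
  · refine ge_of_tendsto (hs.mono_left (nhdsGT_le_nhdsNE a)) ?_
    filter_upwards [hev.filter_mono nhdsWithin_le_nhds, self_mem_nhdsWithin] with z hz hza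
    have h0 : 0 < z - a := sub_pos.2 hza
    rw [abs_of_pos h0] at hz
    rw [slope_def_field, le_div_iff₀ h0]
    linarith
  · refine le_of_tendsto (hs.mono_left (nhdsLT_le_nhdsNE a)) ?_
    filter_upwards [hev.filter_mono nhdsWithin_le_nhds, self_mem_nhdsWithin] with z hz hza
    have h0 : z - a < 0 := sub_neg.2 hza
    rw [abs_of_neg h0] at hz
    rw [slope_def_field, div_le_iff_of_neg h0]
    linarith

/-- An open set meeting every neighbourhood of `q` contains a gap interval between two points
`p < q < r` of its complement. -/
lemma IsOpen.exists_Ioo_gap {U : Set ℝ} (hU : IsOpen U) {p q r : ℝ} (hpq : p < q)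
    (hqr : q < r) (hp : p ∉ U) (hq : q ∈ closure U) (hr : r ∉ U) :
    ∃ a b, p ≤ a ∧ a < b ∧ b ≤ r ∧ a ∉ U ∧ b ∉ U ∧ Ioo a b ⊆ U := by
  obtain ⟨s, ⟨hps, hsr⟩, hs⟩ := mem_closure_iff.1 hq (Ioo p r) isOpen_Ioo ⟨hpq, hqr⟩
  obtain ⟨a, ⟨⟨hpa, has⟩, ha⟩, hamax⟩ :=
    (isCompact_Icc.inter_right hU.isClosed_compl : IsCompact (Icc p s ∩ Uᶜ)).exists_isGreatest
      ⟨p, ⟨le_rfl, hps.le⟩, hp⟩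
  obtain ⟨b, ⟨⟨hsb, hbr⟩, hb⟩, hbmin⟩ :=
    (isCompact_Icc.inter_right hU.isClosed_compl : IsCompact (Icc s r ∩ Uᶜ)).exists_isLeast
      ⟨r, ⟨hsr.le, le_rfl⟩, hr⟩
  have has' : a < s := has.lt_of_ne fun h => ha (h ▸ hs)
  refine ⟨a, b, hpa, has'.trans_le hsb, hbr, ha, hb, fun z hz => ?_⟩
  by_contra hzU
  rcases le_total z s with h | h
  · exact hz.1.not_ge (hamax ⟨⟨hpa.trans hz.1.le, h⟩, hzU⟩)
  · exact hz.2.not_ge (hbmin ⟨⟨h, hz.2.le.trans hbr⟩, hzU⟩)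

lemma Set.Infinite.exists_lt_lt {S : Set ℝ} (hS : S.Infinite) :
    ∃ p ∈ S, ∃ q ∈ S, ∃ r ∈ S, p < q ∧ q < r := by
  obtain ⟨s, hsS, hs⟩ := hS.exists_subset_card_eq 3
  have hmem (i : Fin 3) : s.orderEmbOfFin hs i ∈ S := hsS (s.orderEmbOfFin_mem hs i)
  exact ⟨_, hmem 0, _, hmem 1, _, hmem 2, (s.orderEmbOfFin hs).strictMono (by decide),
    (s.orderEmbOfFin hs).strictMono (by decide)⟩

end RealLine

/-- Where the stability inequality is strict, the evolution is locally constant. -/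
lemma eventually_eq_of_abs_pEx_lt_one {T : ℝ} {E : ℝ → ℝ → ℝ}
    (hE : ContDiff ℝ 2 (Function.uncurry E)) {x : ℝ → ℝ}
    (hBV : BoundedVariationOn x (Icc 0 T)) (hcont : ContinuousOn x (Icc 0 T))
    (hED : EDUB E x T) {u : ℝ} (hu : u ∈ Ioo 0 T) (hlt : |pEx E u (x u)| < 1) :
    ∀ᶠ s in 𝓝 u, x s = x u := by
  have hEd : Differentiable ℝ (Function.uncurry E) := hE.differentiable two_ne_zero
  have hEx : ContDiff ℝ 1 (Function.uncurry (pEx E)) := contDiff_deriv_snd hE (by norm_num)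
  have hEt : ContDiff ℝ 1 (Function.uncurry (pEt E)) := contDiff_deriv_fst hE (by norm_num)
  have hEtc : Continuous (Function.uncurry (pEt E)) := hEt.continuous
  obtain ⟨k, hk, hk1⟩ := exists_between hlt
  obtain ⟨K, W, hW, hLip⟩ := (hEt.contDiffAt (x := (u, x u))).exists_lipschitzOnWith
  have hV : {q | |Function.uncurry (pEx E) q| < k} ∈ 𝓝 (u, x u) :=
    (hEx.continuous.abs.continuousAt (x := (u, x u))).eventually (gt_mem_nhds hk)
  obtain ⟨r, hr, hball⟩ := Metric.mem_nhds_iff.1 (inter_mem hW hV)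
  have hxu : ContinuousAt x u := hcont.continuousAt (Icc_mem_nhds hu.1 hu.2)
  have hgood : ∀ᶠ s in 𝓝 u, s ∈ Ioo 0 T ∧ dist (x s) (x u) < r ∧ dist s u < r :=
    Filter.Eventually.and (isOpen_Ioo.mem_nhds hu)
      ((hxu.eventually (Metric.ball_mem_nhds _ hr)).and (Metric.ball_mem_nhds _ hr))
  obtain ⟨δ, hδ, hδball⟩ := Metric.eventually_nhds_iff.1 hgood
  have hmem {s s' : ℝ} (hs : dist s u < δ) (hs' : dist s' u < δ) :
      (s, x s') ∈ Metric.ball (u, x u) r := by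
    rw [Metric.mem_ball, Prod.dist_eq]
    exact max_lt (hδball hs).2.2 (hδball hs').2.1
  have key {t₁ t₂ : ℝ} (h₁ : dist t₁ u < δ) (h₂ : dist t₂ u < δ) (h12 : t₁ ≤ t₂)
      (hsmall : K * (t₂ - t₁) < 1 - k) : x t₁ = x t₂ := by
    have hsub : Icc t₁ t₂ ⊆ Icc 0 T :=
      Icc_subset_Icc (hδball h₁).1.1.le (hδball h₂).1.2.le
    have hI {s : ℝ} (hs : s ∈ Icc t₁ t₂) : dist s u < δ :=
      (convex_ball u δ).ordConnected.out (Metric.mem_ball.2 h₁) (Metric.mem_ball.2 h₂) hs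
    have hD {s s' : ℝ} (hs : s ∈ Icc t₁ t₂) (hs' : s' ∈ Icc t₁ t₂) :
        |x s - x s'| ≤ Diss x t₁ t₂ := (hBV.mono hsub).dist_le hs hs'
    have hl : t₁ ∈ Icc t₁ t₂ := left_mem_Icc.2 h12
    have hr' : t₂ ∈ Icc t₁ t₂ := right_mem_Icc.2 h12
    have hD12 := hD hr' hl
    have hcx : ContinuousOn (fun s => pEt E s (x s)) (uIcc t₁ t₂) := by
      rw [uIcc_of_le h12]
      exact hEtc.comp_continuousOn (continuousOn_id.prodMk (hcont.mono hsub))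
    have hcc : Continuous fun s => pEt E s (x t₂) :=
      hEtc.comp (continuous_id.prodMk continuous_const)
    have hint : ∫ s in t₁..t₂, pEt E s (x t₂) = E t₂ (x t₂) - E t₁ (x t₂) :=
      intervalIntegral.integral_eq_sub_of_hasDerivAt
        (fun s _ => (hasDerivAt_fst_of_differentiable hEd s (x t₂)).differentiableAt.hasDerivAt)
        (hcc.intervalIntegrable _ _)
    have hdiff : |(∫ s in t₁..t₂, pEt E s (x s)) - ∫ s in t₁..t₂, pEt E s (x t₂)| ≤
        K * Diss x t₁ t₂ * |t₂ - t₁| := by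
      rw [← intervalIntegral.integral_sub hcx.intervalIntegrable (hcc.intervalIntegrable _ _)]
      rw [← Real.norm_eq_abs]
      refine intervalIntegral.norm_integral_le_of_norm_le_const fun s hs => ?_
      rw [uIoc_of_le h12] at hs
      have hs' := Ioc_subset_Icc_self hs
      have h := hLip.dist_le_mul _ (hball (hmem (hI hs') (hI hs'))).1 _
        (hball (hmem (hI hs') h₂)).1
      rw [Prod.dist_eq, dist_self, max_eq_right dist_nonneg] at h
      exact h.trans (mul_le_mul_of_nonneg_left (hD hs' hr') K.2)
    have hmv : |E t₁ (x t₂) - E t₁ (x t₁)| ≤ k * |x t₂ - x t₁| := by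
      refine Convex.norm_image_sub_le_of_norm_deriv_le (f := fun z => E t₁ z)
        (s := Metric.ball (x u) r) (fun z _ =>
          (hasDerivAt_snd_of_differentiable hEd t₁ z).differentiableAt) (fun z hz => ?_)
        (convex_ball _ _) (hδball h₁).2.1 (hδball h₂).2.1
      have hz' : (t₁, z) ∈ Metric.ball (u, x u) r := by
        rw [Metric.mem_ball, Prod.dist_eq]
        exact max_lt (hδball h₁).2.2 hz
      exact (hball hz').2.le
    have hed := hED t₁ t₂ (hδball h₁).1.1.le h12 (hδball h₂).1.2.le
    rw [hint] at hdiff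
    rw [abs_of_nonneg (sub_nonneg.2 h12)] at hdiff
    have h1 := (abs_le.1 hdiff).2
    have h2 := (abs_le.1 hmv).1
    have hk0 : 0 ≤ k := (abs_nonneg _).trans hk.le
    have h3 := mul_le_mul_of_nonneg_left hD12 hk0
    have h4 : (1 - k - K * (t₂ - t₁)) * Diss x t₁ t₂ ≤ 0 := by linarith
    have h5 : Diss x t₁ t₂ ≤ 0 := by
      by_contra! h
      exact h4.not_gt (mul_pos (by linarith) h)
    have h6 : |x t₂ - x t₁| ≤ 0 := hD12.trans h5
    linarith [abs_nonpos_iff.1 h6]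
  have hη : 0 < (1 - k) / (K + 1) := div_pos (by linarith) (by positivity)
  filter_upwards [Metric.ball_mem_nhds u (lt_min hδ hη)] with s hs
  obtain ⟨hs1, hs2⟩ := lt_min_iff.1 (Metric.mem_ball.1 hs)
  have hs3 : K * |s - u| < 1 - k := by
    rw [Real.dist_eq, lt_div_iff₀ (by positivity)] at hs2
    nlinarith [abs_nonneg (s - u)]
  have huu : dist u u < δ := by simpa using hδ
  rcases le_total s u with h | h
  · refine key hs1 huu h ?_
    rwa [abs_sub_comm, abs_of_nonneg (sub_nonneg.2 h)] at hs3
  · refine (key huu hs1 h ?_).symm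
    rwa [abs_of_nonneg (sub_nonneg.2 h)] at hs3

/-- If `G` is stationary in time at `(t, x t)` with nonzero space derivative, and nearby values of
`x` are attained at times, no farther from `t`, where `G` takes the same value as at `(t, x t)`,
then `x` has vanishing derivative at `t`. -/
lemma hasDerivAt_zero_of_level_set {G : ℝ → ℝ → ℝ} (hG : Differentiable ℝ (Function.uncurry G))
    {x : ℝ → ℝ} {t : ℝ} (hx : ContinuousAt x t) (ht : deriv (fun s => G s (x t)) t = 0)
    (hy : deriv (fun z => G t z) (x t) ≠ 0)
    (hlevel : ∀ᶠ s in 𝓝 t, ∃ r, |r - t| ≤ |s - t| ∧ x s = x r ∧ G r (x r) = G t (x t)) :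
    HasDerivAt x 0 t := by
  rw [hasDerivAt_iff_isLittleO, Asymptotics.isLittleO_iff]
  intro ε hε
  rw [(hasDerivAt_fst_of_differentiable hG t (x t)).deriv] at ht
  rw [(hasDerivAt_snd_of_differentiable hG t (x t)).deriv] at hy
  set L := fderiv ℝ (Function.uncurry G) (t, x t) with hL
  set m := L (0, 1) with hm
  have hLv (v w : ℝ) : L (v, w) = w * m := by
    have h : ((v, w) : ℝ × ℝ) = v • (1, 0) + w • (0, 1) := by simp
    rw [h, map_add, map_smul, map_smul, ht, hm]
    simp
  have hm0 : 0 < |m| := abs_pos.2 hy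
  have hc : 0 < min (|m| / 2) (ε * |m| / 2) := lt_min (by positivity) (by positivity)
  have hF := Asymptotics.isLittleO_iff.1 (hG (t, x t)).hasFDerivAt.isLittleO hc
  have hcurve : ∀ᶠ r in 𝓝 t, |(x r - x t) * m - (G r (x r) - G t (x t))| ≤
      min (|m| / 2) (ε * |m| / 2) * (|r - t| + |x r - x t|) := by
    have hpair : ContinuousAt (fun r => (r, x r)) t := continuousAt_id.prodMk hx
    filter_upwards [hpair.eventually hF] with r hr
    rw [abs_sub_comm]
    simp only [Function.uncurry_apply_pair, Prod.mk_sub_mk, ← hL, hLv, Real.norm_eq_abs,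
      Prod.norm_mk] at hr
    exact hr.trans (mul_le_mul_of_nonneg_left
      (max_le_add_of_nonneg (abs_nonneg _) (abs_nonneg _)) hc.le)
  obtain ⟨δ, hδ, hball⟩ := Metric.eventually_nhds_iff.1 hcurve
  filter_upwards [hlevel, Metric.ball_mem_nhds t hδ] with s ⟨r, hrs, hxr, hGr⟩ hs
  have h := hball (y := r) (lt_of_le_of_lt hrs hs)
  rw [hGr, sub_self, sub_zero, abs_mul, ← hxr] at h
  rw [smul_zero, sub_zero, Real.norm_eq_abs, Real.norm_eq_abs]
  have h1 := mul_le_mul_of_nonneg_right (min_le_left (|m| / 2) (ε * |m| / 2))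
    (abs_nonneg (x s - x t))
  have h2 := mul_le_mul_of_nonneg_right (min_le_right (|m| / 2) (ε * |m| / 2)) (abs_nonneg (r - t))
  have h3 : |x s - x t| * (|m| / 2) ≤ ε * |r - t| * (|m| / 2) := by linarith
  exact (le_of_mul_le_mul_right h3 (by positivity)).trans (mul_le_mul_of_nonneg_left hrs hε.le)

/-- for continuous `x` with strong local stability and the energy-dissipation
upper bound, if `t ∈ (0,T)` is an accumulation point of `∂int(N)`, then `∂ₓₜ𝓔(t,x(t)) = 0`;
moreover if `∂ₓₓ𝓔(t,x(t)) ≠ 0` then `x'(t) = 0` and `∂ₓₜₜ𝓔(t,x(t)) = 0`. -/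
theorem accumulation_of_boundary_of_null_set
    (T : ℝ) (hT : 0 < T) (E : ℝ → ℝ → ℝ)
    (hE : ContDiff ℝ 3 (Function.uncurry E))
    (x : ℝ → ℝ) (hBV : BoundedVariationOn x (Set.Icc 0 T))
    (hcont : ContinuousOn x (Set.Icc 0 T))
    (hSLS : ∀ t ∈ Set.Icc 0 T, IsLocalMin (fun z => E t z + |z - x t|) (x t))
    (hED : EDUB E x T)
    (t : ℝ) (ht : t ∈ Set.Ioo 0 T)
    (hacc : AccPt t (𝓟 (frontier (interior (NullSet x T))))) :
    pExt E t (x t) = 0 ∧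
    (pExx E t (x t) ≠ 0 → HasDerivAt x 0 t ∧ pExtt E t (x t) = 0) := by
  have hEx : ContDiff ℝ 2 (Function.uncurry (pEx E)) := contDiff_deriv_snd hE (by norm_num)
  have hExt : ContDiff ℝ 1 (Function.uncurry (pExt E)) := contDiff_deriv_fst hEx (by norm_num)
  have hExd := hEx.differentiable two_ne_zero
  have hExtd := hExt.differentiable one_ne_zero
  have hcurve : ContinuousOn (fun s => pEx E s (x s)) (Icc 0 T) :=
    hEx.continuous.comp_continuousOn (continuousOn_id.prodMk hcont)
  have hnhds : Icc 0 T ∈ 𝓝 t := Icc_mem_nhds ht.1 ht.2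
  have hxt : ContinuousAt x t := hcont.continuousAt hnhds
  have hnull {u : ℝ} (hu : u ∈ Ioo 0 T) (hlt : |pEx E u (x u)| ≠ 1) :
      u ∈ interior (NullSet x T) := by
    have hle : |pEx E u (x u)| ≤ 1 := abs_deriv_le_one_of_isLocalMin_add_abs
      (hasDerivAt_snd_of_differentiable (hE.differentiable three_ne_zero)
        u (x u)).differentiableAt.hasDerivAt (hSLS u (Ioo_subset_Icc_self hu))
    have hev := eventually_eq_of_abs_pEx_lt_one (hE.of_le (by norm_num)) hBV hcont hED hu
      (hle.lt_of_ne hlt)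
    rw [mem_interior_iff_mem_nhds]
    filter_upwards [isOpen_Ioo.mem_nhds hu, hev.eventually_nhds] with s hs hes
    exact ⟨hs, (hasDerivAt_const s (x u)).congr_of_eventuallyEq hes⟩
  have hdisj {u : ℝ} (hu : u ∈ frontier (interior (NullSet x T))) :
      u ∉ interior (NullSet x T) := by
    rw [isOpen_interior.frontier_eq] at hu
    exact hu.2
  have htU : t ∉ interior (NullSet x T) :=
    hdisj (isClosed_frontier.closure_subset hacc.clusterPt.mem_closure)
  have habst : |pEx E t (x t)| = 1 := not_imp_comm.1 (hnull ht) htU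
  have hsign : ∀ᶠ s in 𝓝 t, s ∈ Ioo 0 T ∧
      (s ∉ interior (NullSet x T) → pEx E s (x s) = pEx E t (x t)) := by
    filter_upwards [isOpen_Ioo.mem_nhds ht,
      (hcurve.continuousAt hnhds).eventually (Metric.ball_mem_nhds _ one_pos)] with s hs hds
    refine ⟨hs, fun hsU => ?_⟩
    have h1 : |pEx E s (x s)| = 1 := not_imp_comm.1 (hnull hs) hsU
    have h2 := abs_lt.1 (show |pEx E s (x s) - pEx E t (x t)| < 1 from hds)
    rcases eq_or_eq_neg_of_abs_eq h1 with h | h <;>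
      rcases eq_or_eq_neg_of_abs_eq habst with h' | h' <;> linarith
  obtain ⟨δ, hδ, hball⟩ := Metric.eventually_nhds_iff_ball.1 hsign
  have hzero : ∃ᶠ s in 𝓝[≠] t, pExt E s (x s) = 0 := by
    rw [frequently_nhdsWithin_iff, Metric.nhds_basis_ball.frequently_iff]
    intro ε hε
    have hinf := Set.Infinite.of_accPt
      (hacc.nhds_inter (Metric.ball_mem_nhds t (lt_min hε hδ)))
    obtain ⟨p, ⟨hpb, hp⟩, q, ⟨-, hq⟩, r, ⟨hrb, hr⟩, hpq, hqr⟩ := hinf.exists_lt_lt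
    obtain ⟨a, b, hpa, hab, hbr, ha, hb, hsub⟩ := isOpen_interior.exists_Ioo_gap hpq hqr
      (hdisj hp) (frontier_subset_closure hq) (hdisj hr)
    have hIcc : Icc a b ⊆ Metric.ball t (min ε δ) := (Icc_subset_Icc hpa hbr).trans
      ((convex_ball t _).ordConnected.out hpb hrb)
    have hIccδ := hIcc.trans (Metric.ball_subset_ball (min_le_right _ _))
    have hends : pEx E a (x a) = pEx E b (x b) :=
      ((hball a (hIccδ (left_mem_Icc.2 hab.le))).2 ha).trans
        ((hball b (hIccδ (right_mem_Icc.2 hab.le))).2 hb).symm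
    obtain ⟨c, hc, hc0⟩ := exists_hasDerivAt_eq_zero (f' := fun s => pExt E s (x s)) hab
      (hcurve.mono fun s hs => Ioo_subset_Icc_self (hball s (hIccδ hs)).1) hends
      fun s hs => hasDerivAt_comp_curve_of_hasDerivAt_zero hExd (interior_subset (hsub hs)).2
    exact ⟨c, Metric.ball_subset_ball (min_le_left _ _) (hIcc (Ioo_subset_Icc_self hc)), hc0,
      fun h => htU (h ▸ hsub hc)⟩
  have hExt0 : pExt E t (x t) = 0 := by
    by_contra hne
    have hcE : ContinuousAt (fun s => pExt E s (x s)) t :=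
      hExt.continuous.continuousAt.comp (continuousAt_id.prodMk hxt)
    exact hzero ((hcE.eventually_ne hne).filter_mono nhdsWithin_le_nhds)
  refine ⟨hExt0, fun hExx => ?_⟩
  have hx0 : HasDerivAt x 0 t := by
    refine hasDerivAt_zero_of_level_set hExd hxt hExt0 hExx ?_
    filter_upwards [Metric.ball_mem_nhds t hδ] with s hs
    have huIcc : uIcc t s ⊆ Metric.ball t δ :=
      (convex_ball t δ).ordConnected.uIcc_subset (Metric.mem_ball_self hδ) hs
    obtain ⟨r, ⟨hr, hrU⟩, hmin⟩ := (isCompact_uIcc.inter_right isOpen_interior.isClosed_compl :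
      IsCompact (uIcc t s ∩ (interior (NullSet x T))ᶜ)).exists_isMinOn
      ⟨t, left_mem_uIcc, htU⟩ (f := fun r => |r - s|) (by fun_prop)
    refine ⟨r, abs_sub_left_of_mem_uIcc hr, ?_, (hball r (huIcc hr)).2 hrU⟩
    have hrs : uIcc r s ⊆ uIcc t s := uIcc_subset_uIcc hr right_mem_uIcc
    refine (eq_of_forall_hasDerivAt_zero
      (hcont.mono fun z hz => Ioo_subset_Icc_self (hball z (huIcc (hrs hz))).1) fun z hz => ?_).symm
    have hzU : z ∈ interior (NullSet x T) := by
      by_contra hzU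
      have hle : |r - s| ≤ |z - s| := hmin ⟨hrs (Ioo_subset_Icc_self hz), hzU⟩
      rcases le_total r s with h | h
      · rw [min_eq_left h, max_eq_right h] at hz
        rw [abs_of_nonpos (by linarith), abs_of_nonpos (by linarith [hz.2])] at hle
        linarith [hz.1]
      · rw [min_eq_right h, max_eq_left h] at hz
        rw [abs_of_nonneg (by linarith), abs_of_nonneg (by linarith [hz.1])] at hle
        linarith [hz.2]
    exact (interior_subset hzU).2
  refine ⟨hx0, ?_⟩
  by_contra hne
  exact hzero ((hasDerivAt_comp_curve_of_hasDerivAt_zero hExtd hx0).eventually_ne hne)
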